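/- In the root system of type F₄, the number of antichains of the poset of positive roots (Δ⁺, ≤), where α ≤ β iff β − α is a sum of positive roots, is 105; equivalently, the Borel subalgebra of the simple Lie algebra of type F₄ has exactly 105 ad-nilpotent ideals. -/

import Mathlib

/-- The roots of the root system of type `F₄`, realized (scaled by a factor 2) as the integer
vectors of squared length `4` (`±2eᵢ` and `(±1,±1,±1,±1)`, the short roots) and of squared
length `8` (`±2eᵢ ± 2eⱼ`, `i ≠ j`, the long roots). -/
def F4roots : Set (Fin 4 → ℤ) :=
  {v | ∑ i, v i ^ 2 = 4 ∨ ∑ i, v i ^ 2 = 8}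

/-- A system of positive roots for `F₄`: the roots on which the (generic) linear functional
`v ↦ ∑ i, 2 ^ i * v i` is positive. -/
def F4pos : Set (Fin 4 → ℤ) :=
  {v | v ∈ F4roots ∧ 0 < ∑ i : Fin 4, 2 ^ i.val * v i}

/-- The partial order on positive roots: `α ≤ β` iff `β − α` is a (possibly empty) sum of
positive roots. -/
def rootLe (pos : Set (Fin 4 → ℤ)) (a b : Fin 4 → ℤ) : Prop :=
  ∃ l : Multiset (Fin 4 → ℤ), (∀ x ∈ l, x ∈ pos) ∧ b = a + l.sum

/-- The positive roots of `F₄`, listed by increasing height. -/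
def posRootList : List (Fin 4 → ℤ) :=
  [![-2, 2, 0, 0], ![-1, -1, -1, 1], ![0, -2, 2, 0], ![2, 0, 0, 0],
    ![-2, 0, 2, 0], ![0, 2, 0, 0], ![1, -1, -1, 1], ![-1, 1, -1, 1],
    ![0, 0, 2, 0], ![2, 2, 0, 0], ![-1, -1, 1, 1], ![1, 1, -1, 1],
    ![2, 0, 2, 0], ![0, 0, -2, 2], ![0, 2, 2, 0], ![1, -1, 1, 1],
    ![-1, 1, 1, 1], ![0, -2, 0, 2], ![-2, 0, 0, 2], ![1, 1, 1, 1],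
    ![0, 0, 0, 2], ![2, 0, 0, 2], ![0, 2, 0, 2], ![0, 0, 2, 2]]

/-- Twice the vector of coefficients of `v` with respect to the simple roots
`2e₀`, `2e₁ - 2e₀`, `2e₂ - 2e₁` and `e₃ - e₀ - e₁ - e₂`. -/
def simpleCoeffs : (Fin 4 → ℤ) →+ (Fin 4 → ℤ) where
  toFun v := ![v 0 + v 1 + v 2 + 3 * v 3, v 1 + v 2 + 2 * v 3, v 2 + v 3, 2 * v 3]
  map_zero' := by ext i; fin_cases i <;> simp
  map_add' u v := by ext i; fin_cases i <;> simp <;> ring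

/-- The coefficientwise order on vectors with respect to the simple roots. -/
abbrev coeffLe (a b : Fin 4 → ℤ) : Prop :=
  ∀ i, simpleCoeffs a i ≤ simpleCoeffs b i

theorem mem_F4pos_iff {v : Fin 4 → ℤ} : v ∈ F4pos ↔ v ∈ posRootList := by
  constructor
  · intro hv
    have key : ∀ a ∈ Finset.Icc (-2 : ℤ) 2, ∀ b ∈ Finset.Icc (-2 : ℤ) 2,
        ∀ c ∈ Finset.Icc (-2 : ℤ) 2, ∀ d ∈ Finset.Icc (-2 : ℤ) 2,
        (a ^ 2 + b ^ 2 + c ^ 2 + d ^ 2 = 4 ∨ a ^ 2 + b ^ 2 + c ^ 2 + d ^ 2 = 8) →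
        0 < a + 2 * b + 4 * c + 8 * d → ![a, b, c, d] ∈ posRootList := by
      decide +kernel
    obtain ⟨hnorm, hpos⟩ := hv
    simp only [F4roots, Set.mem_ofPred_eq, Fin.sum_univ_four] at hnorm hpos
    have hvec : v = ![v 0, v 1, v 2, v 3] := by ext i; fin_cases i <;> rfl
    have hbound (i : Fin 4) : v i ∈ Finset.Icc (-2 : ℤ) 2 := by
      have hi : v i ^ 2 ≤ ∑ j, v j ^ 2 :=
        Finset.single_le_sum (f := fun j => v j ^ 2) (fun j _ => sq_nonneg (v j))
          (Finset.mem_univ i)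
      have hi8 : v i ^ 2 ≤ 8 := by
        rw [Fin.sum_univ_four] at hi
        omega
      rw [Finset.mem_Icc]
      constructor <;> nlinarith
    rw [hvec]
    exact key _ (hbound 0) _ (hbound 1) _ (hbound 2) _ (hbound 3) hnorm (by simpa using hpos)
  · have key : ∀ v ∈ posRootList,
        (∑ i, v i ^ 2 = 4 ∨ ∑ i, v i ^ 2 = 8) ∧ 0 < ∑ i : Fin 4, 2 ^ i.val * v i := by
      decide +kernel
    exact key v

theorem rootLe_iff_sub_mem_closure {pos : Set (Fin 4 → ℤ)} {a b : Fin 4 → ℤ} :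
    rootLe pos a b ↔ b - a ∈ AddSubmonoid.closure pos := by
  constructor
  · rintro ⟨l, hl, rfl⟩
    rw [add_sub_cancel_left]
    exact AddSubmonoid.multiset_sum_mem _ _ fun x hx => AddSubmonoid.subset_closure (hl x hx)
  · intro h
    obtain ⟨l, hl, hsum⟩ := AddSubmonoid.exists_multiset_of_mem_closure h
    exact ⟨l, hl, by rw [hsum, add_sub_cancel]⟩

theorem simpleCoeffs_nonneg {v : Fin 4 → ℤ} (hv : v ∈ AddSubmonoid.closure F4pos) :
    0 ≤ simpleCoeffs v := by
  induction hv using AddSubmonoid.closure_induction with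
  | mem x hx =>
    have key : ∀ x ∈ posRootList, ∀ i, 0 ≤ simpleCoeffs x i := by decide +kernel
    exact key x (mem_F4pos_iff.mp hx)
  | zero => rw [map_zero]
  | add x y _ _ hx hy => rw [map_add]; exact add_nonneg hx hy

theorem two_dvd_simpleCoeffs {v : Fin 4 → ℤ} (hv : v ∈ F4pos) (i : Fin 4) :
    2 ∣ simpleCoeffs v i := by
  have key : ∀ x ∈ posRootList, ∀ i, 2 ∣ simpleCoeffs x i := by decide +kernel
  exact key v (mem_F4pos_iff.mp hv) i

theorem mem_closure_F4pos {v : Fin 4 → ℤ} (heven : ∀ i, 2 ∣ simpleCoeffs v i)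
    (hnonneg : ∀ i, 0 ≤ simpleCoeffs v i) : v ∈ AddSubmonoid.closure F4pos := by
  have hcoeff (i : Fin 4) : ∃ n : ℕ, simpleCoeffs v i = 2 * n := by
    obtain ⟨k, hk⟩ := heven i
    have := hnonneg i
    exact ⟨k.toNat, by omega⟩
  choose n hn using hcoeff
  have hsum : v = n 0 • ![2, 0, 0, 0] + n 1 • ![-2, 2, 0, 0] + n 2 • ![0, -2, 2, 0] +
      n 3 • ![-1, -1, -1, 1] := by
    have h0 := hn 0
    have h1 := hn 1
    have h2 := hn 2
    have h3 := hn 3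
    simp [simpleCoeffs] at h0 h1 h2 h3
    ext i
    fin_cases i <;> simp <;> omega
  have hmem {x : Fin 4 → ℤ} (hx : x ∈ posRootList) (k : ℕ) :
      k • x ∈ AddSubmonoid.closure F4pos :=
    nsmul_mem (AddSubmonoid.subset_closure (mem_F4pos_iff.mpr hx)) k
  rw [hsum]
  exact add_mem (add_mem (add_mem (hmem (by decide +kernel) _) (hmem (by decide +kernel) _))
    (hmem (by decide +kernel) _)) (hmem (by decide +kernel) _)

theorem rootLe_F4pos_iff {a b : Fin 4 → ℤ} (ha : a ∈ F4pos) (hb : b ∈ F4pos) :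
    rootLe F4pos a b ↔ coeffLe a b := by
  rw [rootLe_iff_sub_mem_closure]
  constructor
  · intro h i
    have := simpleCoeffs_nonneg h i
    rw [map_sub] at this
    exact sub_nonneg.mp this
  · intro h
    refine mem_closure_F4pos (fun i => ?_) fun i => ?_ <;> rw [map_sub, Pi.sub_apply]
    · exact dvd_sub (two_dvd_simpleCoeffs hb i) (two_dvd_simpleCoeffs ha i)
    · exact sub_nonneg.mpr (h i)

section Counting

variable {α : Type*} (r : α → α → Prop)

/-- Antichains contained in `insert a s` either avoid `a`, or consist of `a` and an antichain of
elements of `s` incomparable to `a`. -/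
theorem encard_antichains_insert {a : α} {s : Set α} (ha : a ∉ s) :
    {A : Set α | A ⊆ insert a s ∧ IsAntichain r A}.encard =
      {A : Set α | A ⊆ s ∧ IsAntichain r A}.encard +
      {A : Set α | A ⊆ {x | x ∈ s ∧ ¬r a x ∧ ¬r x a} ∧ IsAntichain r A}.encard := by
  set t := {x | x ∈ s ∧ ¬r a x ∧ ¬r x a}
  have hat : a ∉ t := fun h => ha h.1
  have hinj : Set.InjOn (insert a) {A : Set α | A ⊆ t ∧ IsAntichain r A} := by
    intro A hA B hB hAB
    rw [← Set.insert_sdiff_self_of_notMem fun h => hat (hA.1 h),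
      ← Set.insert_sdiff_self_of_notMem fun h => hat (hB.1 h), hAB]
  rw [← hinj.encard_image, ← Set.encard_union_eq]
  · congr 1
    ext A
    constructor
    · rintro ⟨hsub, hA⟩
      by_cases haA : a ∈ A
      · refine Or.inr ⟨A \ {a}, ⟨fun x hx => ?_, hA.subset Set.sdiff_subset⟩,
          by simp [haA]⟩
        have hxa : x ≠ a := hx.2
        exact ⟨(hsub hx.1).resolve_left hxa, hA haA hx.1 hxa.symm, hA hx.1 haA hxa⟩
      · exact Or.inl ⟨(Set.subset_insert_iff_of_notMem haA).mp hsub, hA⟩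
    · rintro (⟨hsub, hA⟩ | ⟨B, ⟨hsub, hB⟩, rfl⟩)
      · exact ⟨hsub.trans (Set.subset_insert a s), hA⟩
      · exact ⟨Set.insert_subset_insert fun x hx => (hsub hx).1,
          hB.insert (fun x hx _ => (hsub hx).2.2) fun x hx _ => (hsub hx).2.1⟩
  · rw [Set.disjoint_left]
    rintro _ ⟨hsub, _⟩ ⟨B, _, rfl⟩
    exact ha (hsub (Set.mem_insert a B))

theorem encard_antichains_nil :
    {A : Set α | A ⊆ {x | x ∈ ([] : List α)} ∧ IsAntichain r A}.encard = 1 := by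
  rw [Set.encard_eq_one]
  refine ⟨∅, Set.ext fun A => ⟨fun h => ?_, ?_⟩⟩
  · exact Set.eq_empty_of_forall_notMem fun x hx => List.not_mem_nil (h.1 hx)
  · rintro rfl
    exact ⟨Set.empty_subset _, Set.pairwise_empty _⟩

variable [DecidableRel r]

/-- The number of antichains of elements of `l`, provided that `l` has no repetitions and that
its length is at most the first argument. -/
def countAntichains : ℕ → List α → ℕ
  | _, [] => 1
  | 0, _ => 0
  | n + 1, a :: l =>
    countAntichains n l + countAntichains n (l.filter fun x => ¬r a x ∧ ¬r x a)

theorem encard_antichains_eq_countAntichains (n : ℕ) (l : List α) (hl : l.Nodup)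
    (hn : l.length ≤ n) :
    {A : Set α | A ⊆ {x | x ∈ l} ∧ IsAntichain r A}.encard = countAntichains r n l := by
  induction n generalizing l with
  | zero =>
    obtain rfl := List.length_eq_zero_iff.mp (Nat.le_zero.mp hn)
    rw [encard_antichains_nil, countAntichains, Nat.cast_one]
  | succ n ih =>
    cases l with
    | nil => rw [encard_antichains_nil, countAntichains, Nat.cast_one]
    | cons a l =>
      obtain ⟨ha, hl⟩ := List.nodup_cons.mp hl
      have hlen : l.length ≤ n := Nat.le_of_succ_le_succ hn
      have hcons : {x | x ∈ a :: l} = insert a {x | x ∈ l} := by ext; simp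
      have hfilter := ih (l.filter fun x => ¬r a x ∧ ¬r x a) (hl.filter _)
        ((List.length_filter_le _ _).trans hlen)
      simp only [List.mem_filter, decide_eq_true_eq] at hfilter
      rw [hcons, encard_antichains_insert r ha, countAntichains, Nat.cast_add, ← ih l hl hlen,
        ← hfilter]
      rfl

end Counting

/-- In the root system of type `F₄`, the number of antichains of the poset of
positive roots `(Δ⁺, ≤)`, where `α ≤ β` iff `β − α` is a sum of positive roots, is `105`;
equivalently, the Borel subalgebra of the simple Lie algebra of type `F₄` has exactly `105`
ad-nilpotent ideals. -/
theorem stmt12 :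
    {A : Set (Fin 4 → ℤ) | A ⊆ F4pos ∧ IsAntichain (rootLe F4pos) A}.ncard = 105 := by
  have hset : {A : Set (Fin 4 → ℤ) | A ⊆ F4pos ∧ IsAntichain (rootLe F4pos) A} =
      {A | A ⊆ {x | x ∈ posRootList} ∧ IsAntichain coeffLe A} := by
    have hpos : F4pos = {x | x ∈ posRootList} := Set.ext fun _ => mem_F4pos_iff
    rw [← hpos]
    ext A
    refine and_congr_right fun hA => ⟨fun h a ha b hb hab => ?_, fun h a ha b hb hab => ?_⟩
    · exact fun hle => h ha hb hab ((rootLe_F4pos_iff (hA ha) (hA hb)).mpr hle)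
    · exact fun hle => h ha hb hab ((rootLe_F4pos_iff (hA ha) (hA hb)).mp hle)
  have hcount : countAntichains coeffLe 24 posRootList = 105 := by decide +kernel
  rw [hset, Set.ncard, encard_antichains_eq_countAntichains coeffLe 24 posRootList
    (by decide +kernel) (by decide +kernel), hcount]
  rfl
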